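/- arXiv:1401.4689 — 2 statements merged into one kernel-verified Lean document; each statement's English description precedes it below -/
import Mathlib

section
/- Let S be a finite alphabet with a complementation, let V ⊆ S^d be a polybox code which does not contain a twin pair, and let w, u ∈ S^d with w, u ∉ V be two words covered by V (w̌ ⊆ ⋃_{v∈V} v̌ and ǔ ⊆ ⋃_{v∈V} v̌) such that w and u are dichotomous but do not form a twin pair. Then |V| ≥ 7. -/
variable {S : Type}

/-- Two words are dichotomous: at some position they carry complementary letters. -/
def Dicho {d : ℕ} (c : S → S) (u v : Fin d → S) : Prop := ∃ j, v j = c (u j)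

/-- Two words form a twin pair. -/
def TwinPair {d : ℕ} (c : S → S) (u v : Fin d → S) : Prop :=
  ∃ j, v j = c (u j) ∧ ∀ i, i ≠ j → v i = u i

/-- A polybox code: a set of pairwise dichotomous words. -/
def PolyboxCode {d : ℕ} (c : S → S) (V : Set (Fin d → S)) : Prop :=
  ∀ u ∈ V, ∀ v ∈ V, u ≠ v → Dicho c u v

/-- The code contains no twin pair. -/
def NoTwinPair {d : ℕ} (c : S → S) (V : Set (Fin d → S)) : Prop :=
  ∀ u ∈ V, ∀ v ∈ V, ¬ TwinPair c u v

/-- `ES`: sets containing exactly one of `s`, `s'` for every letter `s`. -/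
def ESet (c : S → S) : Set (Set S) := {B | ∀ s, Xor' (s ∈ B) (c s ∈ B)}

/-- `Es`: members of `ES` containing the letter `s`. -/
def ELetter (c : S → S) (s : S) : Set (Set S) := {B | B ∈ ESet c ∧ s ∈ B}

/-- The equicomplementary realization `v̌ ⊆ (ES)^d` of a word `v`. -/
def Realize {d : ℕ} (c : S → S) (v : Fin d → S) : Set (Fin d → Set S) :=
  {x | ∀ i, x i ∈ ELetter c (v i)}

/-- The union `⋃_{v ∈ V} v̌`. -/
def RealizeSet {d : ℕ} (c : S → S) (V : Set (Fin d → S)) : Set (Fin d → Set S) :=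
  ⋃ v ∈ V, Realize c v

/-- Two codes are equivalent if their realizations coincide. -/
def EquivCodes {d : ℕ} (c : S → S) (V W : Set (Fin d → S)) : Prop :=
  RealizeSet c V = RealizeSet c W

/-- A partition code: a polybox code whose realization is the whole box `(ES)^d`. -/
def PartitionCode {d : ℕ} (c : S → S) (U : Set (Fin d → S)) : Prop :=
  PolyboxCode c U ∧ RealizeSet c U = {x | ∀ i, x i ∈ ESet c}

/-- `V^{i,l}`: the words of `V` with letter `l` at position `i`. -/
def Subcode {d : ℕ} (V : Set (Fin d → S)) (i : Fin d) (l : S) : Set (Fin d → S) :=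
  {v | v ∈ V ∧ v i = l}

/-- Every consistent set of letters extends to a member of `ES`. -/
theorem exists_mem_ESet_superset [Finite S] {c : S → S} (hinv : Function.Involutive c)
    (hfix : ∀ s, c s ≠ s) (T : Set S) (hT : ∀ s ∈ T, c s ∉ T) : ∃ B ∈ ESet c, T ⊆ B := by
  obtain ⟨n, ⟨f⟩⟩ := Finite.exists_equiv_fin S
  refine ⟨{s | s ∈ T ∨ (c s ∉ T ∧ f s < f (c s))}, fun s => ?_, fun s hs => Or.inl hs⟩
  have h1 := hT s
  have h2 := hT (c s)
  have h3 : f s ≠ f (c s) := fun h => hfix s (f.injective h).symm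
  rw [hinv s] at h2
  simp only [Set.mem_ofPred_eq, hinv s]
  rcases lt_or_gt_of_ne h3 with h | h
  · have := h.not_gt
    tauto
  · have := h.not_gt
    tauto

theorem exists_mem_ESet_pair [Finite S] {c : S → S} (hinv : Function.Involutive c)
    (hfix : ∀ s, c s ≠ s) {a b : S} (h : b ≠ c a) : ∃ B ∈ ESet c, a ∈ B ∧ b ∈ B := by
  obtain ⟨B, hB, hT⟩ := exists_mem_ESet_superset hinv hfix {a, b} (by
    have := hfix a
    have := hfix b
    have := hinv b
    rintro s (rfl | rfl) <;> simp <;> grind)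
  exact ⟨B, hB, hT (by simp), hT (by simp)⟩

theorem exists_mem_ESet_pair_of_ne [Finite S] {c : S → S} (hinv : Function.Involutive c)
    (hfix : ∀ s, c s ≠ s) {a b t : S} (h : b ≠ c a) (hta : t ≠ a) (htb : t ≠ b) :
    ∃ B ∈ ESet c, a ∈ B ∧ b ∈ B ∧ c t ∈ B := by
  obtain ⟨B, hB, hT⟩ := exists_mem_ESet_superset hinv hfix {a, b, c t} (by
    have := hfix a
    have := hfix b
    have := hfix (c t)
    have := hinv a
    have := hinv b
    have := hinv t
    rintro s (rfl | rfl | rfl) <;> simp <;> grind)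
  exact ⟨B, hB, hT (by simp), hT (by simp), hT (by simp)⟩

theorem mem_iff_of_mem_ESet {c : S → S} {B : Set S} (hB : B ∈ ESet c) (s : S) :
    c s ∈ B ↔ s ∉ B := by
  have : (s ∈ B ∧ c s ∉ B) ∨ (c s ∈ B ∧ s ∉ B) := hB s
  tauto

/-- Replacing the letter `s` of a member of `ES` by its complement. -/
theorem exists_flip {c : S → S} (hinv : Function.Involutive c) (hfix : ∀ s, c s ≠ s)
    {B : Set S} (hB : B ∈ ESet c) {s : S} (hs : s ∈ B) :
    ∃ B' ∈ ESet c, s ∉ B' ∧ c s ∈ B' ∧ ∀ t, t ≠ s → t ≠ c s → (t ∈ B' ↔ t ∈ B) := by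
  refine ⟨{t | t = c s ∨ (t ≠ s ∧ t ∈ B)}, fun t => ?_, ?_, ?_, ?_⟩
  · have h1 := mem_iff_of_mem_ESet hB t
    have h2 := mem_iff_of_mem_ESet hB s
    have h3 := hinv t
    have h4 := hinv s
    have h5 := hfix s
    have h6 := hfix t
    change (t = c s ∨ t ≠ s ∧ t ∈ B) ∧ ¬(c t = c s ∨ c t ≠ s ∧ c t ∈ B) ∨
      (c t = c s ∨ c t ≠ s ∧ c t ∈ B) ∧ ¬(t = c s ∨ t ≠ s ∧ t ∈ B)
    by_cases h : t = s
    · subst h; grind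
    · by_cases h' : t = c s
      · subst h'; grind
      · have : c t ≠ c s := fun e => h (hinv.injective e)
        have : c t ≠ s := by rintro rfl; exact h' h3.symm
        grind
  · have := hfix s
    grind
  · simp
  · intro t h1 h2
    simp [h1, h2]

/-- `V` is a twin-pair free polybox code covering `w`, not containing `w`, and every word of `V`
meets `w`. -/
structure TightCover {d : ℕ} (c : S → S) (V : Finset (Fin d → S)) (w : Fin d → S) : Prop where
  code : PolyboxCode c (V : Set (Fin d → S))
  noTwin : NoTwinPair c (V : Set (Fin d → S))
  compat : ∀ v ∈ V, ∀ k, v k ≠ c (w k)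
  cover : ∀ B ∈ Realize c w, ∃ v ∈ V, B ∈ Realize c v
  notMem : w ∉ V

theorem eq_of_mem_realize {d : ℕ} {c : S → S} {V : Set (Fin d → S)} (hV : PolyboxCode c V)
    {u v : Fin d → S} (hu : u ∈ V) (hv : v ∈ V) {B : Fin d → Set S}
    (hBu : B ∈ Realize c u) (hBv : B ∈ Realize c v) : u = v := by
  by_contra hne
  obtain ⟨j, hj⟩ := hV u hu v hv hne
  have h1 := hBv j
  rw [hj] at h1
  exact (mem_iff_of_mem_ESet h1.1 _).1 h1.2 (hBu j).2

theorem polyboxCode_filter {d : ℕ} {c : S → S} {V : Finset (Fin d → S)}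
    (hV : PolyboxCode c (V : Set (Fin d → S)))
    (p : (Fin d → S) → Prop) [DecidablePred p] :
    PolyboxCode c ((V.filter p : Finset (Fin d → S)) : Set (Fin d → S)) :=
  fun u hu v hv => hV u (by simp at hu; simp [hu]) v (by simp at hv; simp [hv])

theorem noTwinPair_filter {d : ℕ} {c : S → S} {V : Finset (Fin d → S)}
    (hV : NoTwinPair c (V : Set (Fin d → S)))
    (p : (Fin d → S) → Prop) [DecidablePred p] :
    NoTwinPair c ((V.filter p : Finset (Fin d → S)) : Set (Fin d → S)) :=
  fun u hu v hv => hV u (by simp at hu; simp [hu]) v (by simp at hv; simp [hv])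

theorem tightCover_filter {d : ℕ} [DecidableEq S] {c : S → S} {V : Finset (Fin d → S)}
    {w : Fin d → S} (hV : PolyboxCode c (V : Set (Fin d → S)))
    (hVt : NoTwinPair c (V : Set (Fin d → S)))
    (hcov : ∀ B ∈ Realize c w, ∃ v ∈ V, B ∈ Realize c v) (hw : w ∉ V) :
    TightCover c (V.filter fun v => ∀ k, v k ≠ c (w k)) w where
  code := polyboxCode_filter hV _
  noTwin := noTwinPair_filter hVt _
  compat v hv := (Finset.mem_filter.1 hv).2
  cover B hB := by
    obtain ⟨v, hv, hBv⟩ := hcov B hB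
    refine ⟨v, Finset.mem_filter.2 ⟨hv, fun k hk => ?_⟩, hBv⟩
    have h1 := hBv k
    rw [hk] at h1
    exact (mem_iff_of_mem_ESet h1.1 _).1 h1.2 (hB k).2
  notMem h := hw (Finset.mem_filter.1 h).1

namespace TightCover

variable {d : ℕ} {c : S → S} {V : Finset (Fin d → S)} {w : Fin d → S}

theorem exists_flip_mem (h : TightCover c V w) (hinv : Function.Involutive c)
    (hfix : ∀ s, c s ≠ s) {a : Fin d → S} (ha : a ∈ V) {i : Fin d} (hi : a i ≠ w i)
    {B : Fin d → Set S} (hBw : B ∈ Realize c w) (hBa : B ∈ Realize c a) :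
    ∃ v ∈ V, v i = c (a i) ∧ ∀ m, m ≠ i → v m ∈ B m := by
  obtain ⟨C, hC, hs, hcs, hCB⟩ := exists_flip hinv hfix (hBa i).1 (hBa i).2
  have hwi : w i ≠ c (a i) := fun e => h.compat a ha i (by rw [e, hinv])
  obtain ⟨v, hv, hBv⟩ := h.cover (Function.update B i C) (fun m => by
    by_cases hm : m = i
    · subst hm
      simpa using ⟨hC, (hCB _ hi.symm hwi).2 (hBw m).2⟩
    · simpa [hm] using hBw m)
  have hvm : ∀ m, m ≠ i → v m ∈ B m := fun m hm => by simpa [hm] using (hBv m).2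
  refine ⟨v, hv, ?_, hvm⟩
  by_contra hne
  have hvi : v i ∈ C := by simpa using (hBv i).2
  have hva : v i ≠ a i := fun e => hs (e ▸ hvi)
  have : v = a := eq_of_mem_realize h.code hv ha (B := B) (fun m => by
    by_cases hm : m = i
    · subst hm
      exact ⟨(hBw m).1, (hCB _ hva hne).1 hvi⟩
    · exact ⟨(hBw m).1, hvm m hm⟩) hBa
  exact hva (by rw [this])

theorem exists_point [Finite S] (h : TightCover c V w) (hinv : Function.Involutive c)
    (hfix : ∀ s, c s ≠ s) {a : Fin d → S} (ha : a ∈ V) :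
    ∃ B, B ∈ Realize c w ∧ B ∈ Realize c a := by
  choose B hB h1 h2 using fun m => exists_mem_ESet_pair hinv hfix (h.compat a ha m)
  exact ⟨B, fun m => ⟨hB m, h1 m⟩, fun m => ⟨hB m, h2 m⟩⟩

theorem exists_compl [Finite S] (h : TightCover c V w) (hinv : Function.Involutive c)
    (hfix : ∀ s, c s ≠ s) {a : Fin d → S} (ha : a ∈ V) {i : Fin d} (hi : a i ≠ w i) :
    ∃ v ∈ V, v i = c (a i) ∧ ∀ m, m ≠ i → v m ≠ c (a m) := by
  obtain ⟨B, hBw, hBa⟩ := h.exists_point hinv hfix ha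
  obtain ⟨v, hv, hvi, hvm⟩ := h.exists_flip_mem hinv hfix ha hi hBw hBa
  exact ⟨v, hv, hvi, fun m hm e =>
    (mem_iff_of_mem_ESet (hBw m).1 (a m)).1 (e ▸ hvm m hm) (hBa m).2⟩

theorem exists_compl_ne [Finite S] (h : TightCover c V w) (hinv : Function.Involutive c)
    (hfix : ∀ s, c s ≠ s) {a : Fin d → S} (ha : a ∈ V) {i k : Fin d} (hi : a i ≠ w i)
    (hk : k ≠ i) {t : S} (hta : t ≠ a k) (htw : t ≠ w k) :
    ∃ v ∈ V, v i = c (a i) ∧ v k ≠ t ∧ ∀ m, m ≠ i → v m ≠ c (a m) := by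
  obtain ⟨B, hBw, hBa⟩ := h.exists_point hinv hfix ha
  obtain ⟨C, hC, hCw, hCa, hCt⟩ := exists_mem_ESet_pair_of_ne hinv hfix (h.compat a ha k) htw hta
  have hBw' : Function.update B k C ∈ Realize c w := fun m => by
    by_cases hm : m = k
    · subst hm
      simpa using ⟨hC, hCw⟩
    · simpa [hm] using hBw m
  have hBa' : Function.update B k C ∈ Realize c a := fun m => by
    by_cases hm : m = k
    · subst hm
      simpa using ⟨hC, hCa⟩
    · simpa [hm] using hBa m
  obtain ⟨v, hv, hvi, hvm⟩ := h.exists_flip_mem hinv hfix ha hi hBw' hBa'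
  refine ⟨v, hv, hvi, fun e => ?_, fun m hm e =>
    (mem_iff_of_mem_ESet (hBw' m).1 (a m)).1 (e ▸ hvm m hm) (hBa' m).2⟩
  have := hvm k hk
  rw [e, Function.update_self] at this
  exact (mem_iff_of_mem_ESet hC t).1 hCt this

/-- If `a` is the only word of `V` with its letter at position `i`, then the twin of `a` at `i`
is covered by the words of `V` with the complementary letter at `i`. -/
theorem cover_twin [Finite S] (h : TightCover c V w) (hinv : Function.Involutive c)
    (hfix : ∀ s, c s ≠ s) {a : Fin d → S} (ha : a ∈ V) {i : Fin d} (hi : a i ≠ w i)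
    (huniq : ∀ v ∈ V, v i = a i → v = a) {B : Fin d → Set S}
    (hB : B ∈ Realize c (Function.update a i (c (a i)))) :
    ∃ v ∈ V, v i = c (a i) ∧ B ∈ Realize c v := by
  classical
  have key : ∀ v ∈ V, v i = c (a i) → ∀ k, k ≠ i → a k ≠ w k → v k = a k := by
    intro v hv hvi k hk hak
    by_contra hne
    obtain ⟨b, hb, hbi, hbk, -⟩ := h.exists_compl_ne hinv hfix hv (i := i)
      (fun e => h.compat a ha i (by rw [← e, hvi, hinv])) hk (Ne.symm hne) hak
    rw [hvi, hinv] at hbi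
    exact hbk (by rw [huniq b hb hbi])
  obtain ⟨C, hCw, hCa⟩ := h.exists_point hinv hfix ha
  let D : Fin d → Set S := fun k => if k ≠ i ∧ a k = w k then B k else C k
  have hD : D ∈ Realize c w ∧ D ∈ Realize c a := by
    refine ⟨fun k => ?_, fun k => ?_⟩ <;> by_cases hk : k ≠ i ∧ a k = w k
    · have := hB k
      simp only [Function.update_of_ne hk.1] at this
      simpa only [D, if_pos hk, ← hk.2] using this
    · simpa only [D, if_neg hk] using hCw k
    · have := hB k
      simp only [Function.update_of_ne hk.1] at this
      simpa only [D, if_pos hk] using this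
    · simpa only [D, if_neg hk] using hCa k
  obtain ⟨v, hv, hvi, hvm⟩ := h.exists_flip_mem hinv hfix ha hi hD.1 hD.2
  refine ⟨v, hv, hvi, fun m => ?_⟩
  have hBm := hB m
  by_cases hm : m = i
  · subst hm
    rw [Function.update_self] at hBm
    rwa [hvi]
  · rw [Function.update_of_ne hm] at hBm
    by_cases haw : a m = w m
    · have := hvm m hm
      simp only [D, if_pos (show m ≠ i ∧ a m = w m from ⟨hm, haw⟩)] at this
      exact ⟨hBm.1, this⟩
    · rwa [key v hv hvi m hm haw]

/-- If all words of `V` carry `x` or `x'` at position `i`, then those with letter `x` cover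
the word obtained from `w` by placing `x` at `i`. -/
theorem cover_update [Finite S] (h : TightCover c V w) (hinv : Function.Involutive c)
    (hfix : ∀ s, c s ≠ s) {i : Fin d} {x : S} (hx : x ≠ c (w i))
    (hall : ∀ v ∈ V, v i = x ∨ v i = c x) {B : Fin d → Set S}
    (hB : B ∈ Realize c (Function.update w i x)) :
    ∃ v ∈ V, v i = x ∧ B ∈ Realize c v := by
  obtain ⟨C, hC, hCw, hCx⟩ := exists_mem_ESet_pair hinv hfix hx
  obtain ⟨v, hv, hBv⟩ := h.cover (Function.update B i C) (fun m => by
    by_cases hm : m = i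
    · subst hm
      simpa using ⟨hC, hCw⟩
    · simpa [hm] using hB m)
  have hvi : v i = x := by
    refine (hall v hv).resolve_right fun e => ?_
    have := hBv i
    rw [e, Function.update_self] at this
    exact (mem_iff_of_mem_ESet hC x).1 this.2 hCx
  refine ⟨v, hv, hvi, fun m => ?_⟩
  by_cases hm : m = i
  · subst hm
    simpa [hvi] using hB m
  · simpa [hm] using hBv m

theorem eq_update_of_mem (h : TightCover c V w) (hfix : ∀ s, c s ≠ s) {i : Fin d} {x : S}
    (hmem : Function.update w i x ∈ V) {v : Fin d → S} (hv : v ∈ V) (hvi : v i = x) :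
    v = Function.update w i x := by
  by_contra hne
  obtain ⟨j, hj⟩ := h.code _ hmem v hv (Ne.symm hne)
  by_cases hji : j = i
  · subst hji
    rw [Function.update_self, hvi] at hj
    exact hfix x hj.symm
  · rw [Function.update_of_ne hji] at hj
    exact h.compat v hv j hj

theorem exists_ne (h : TightCover c V w) {v : Fin d → S} (hv : v ∈ V) : ∃ i, v i ≠ w i := by
  by_contra! hall
  exact h.notMem (funext hall ▸ hv)

theorem update_compl_notMem (h : TightCover c V w) {a : Fin d → S} (ha : a ∈ V)
    (i : Fin d) : Function.update a i (c (a i)) ∉ V := fun hmem =>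
  h.noTwin a ha _ hmem ⟨i, by simp, fun m hm => by simp [hm]⟩

theorem compl_ne (h : TightCover c V w) (hinv : Function.Involutive c)
    {a : Fin d → S} (ha : a ∈ V) (i : Fin d) : c (a i) ≠ w i := fun e =>
  h.compat a ha i (by rw [← e, hinv])

end TightCover

section Card

variable {d : ℕ} [DecidableEq S] {c : S → S} {V : Finset (Fin d → S)} {w : Fin d → S}

theorem card_filter_add_card_filter_compl_le (hfix : ∀ s, c s ≠ s) (V : Finset (Fin d → S))
    (i : Fin d) (x : S) :
    (V.filter fun v => v i = x).card + (V.filter fun v => v i = c x).card ≤ V.card := by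
  rw [← Finset.card_union_of_disjoint]
  · exact Finset.card_le_card (Finset.union_subset (Finset.filter_subset _ _)
      (Finset.filter_subset _ _))
  · rw [Finset.disjoint_filter]
    intro v _ h1 h2
    exact hfix x (h2.symm.trans h1)

theorem eq_or_eq_compl_of_card_le (hfix : ∀ s, c s ≠ s) {i : Fin d} {x : S}
    (hcard : V.card ≤ (V.filter fun v => v i = x).card + (V.filter fun v => v i = c x).card)
    {v : Fin d → S} (hv : v ∈ V) : v i = x ∨ v i = c x := by
  rw [← Finset.card_union_of_disjoint] at hcard
  · have := Finset.eq_of_subset_of_card_le (Finset.union_subset (Finset.filter_subset _ _)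
      (Finset.filter_subset _ _)) hcard
    rw [← this] at hv
    simp at hv
    tauto
  · rw [Finset.disjoint_filter]
    intro v _ h1 h2
    exact hfix x (h2.symm.trans h1)

/-- A word covered by a twin-pair free code not containing it needs at least five words. -/
theorem five_le_card [Finite S] (hinv : Function.Involutive c) (hfix : ∀ s, c s ≠ s)
    (hV : PolyboxCode c (V : Set (Fin d → S))) (hVt : NoTwinPair c (V : Set (Fin d → S)))
    (hcov : ∀ B ∈ Realize c w, ∃ v ∈ V, B ∈ Realize c v) (hw : w ∉ V) : 5 ≤ V.card := by
  induction hn : V.card using Nat.strong_induction_on generalizing V w with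
  | _ n ih =>
  subst hn
  by_contra! hlt
  have h := tightCover_filter hV hVt hcov hw
  set U := V.filter fun v => ∀ k, v k ≠ c (w k) with hU
  have hUV : U.card ≤ V.card := Finset.card_le_card (Finset.filter_subset _ _)
  choose B hB hBw _ using fun m => exists_mem_ESet_pair hinv hfix (hfix (w m)).symm
  obtain ⟨a, ha, -⟩ := h.cover B fun m => ⟨hB m, hBw m⟩
  obtain ⟨i, hi⟩ := h.exists_ne ha
  obtain ⟨b, hb, hbi, -⟩ := h.exists_compl hinv hfix ha hi
  have hbw : b i ≠ w i := fun e => h.compat a ha i (by rw [← e, hbi, hinv])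
  have hle := card_filter_add_card_filter_compl_le hfix U i (a i)
  have hpos : 0 < (U.filter fun v => v i = a i).card :=
    Finset.card_pos.2 ⟨a, by simp [ha]⟩
  have hpos' : 0 < (U.filter fun v => v i = c (a i)).card :=
    Finset.card_pos.2 ⟨b, by simp [hb, hbi]⟩
  have step : ∀ a ∈ U, a i ≠ w i → (U.filter fun v => v i = a i).card ≤ 1 →
      (U.filter fun v => v i = c (a i)).card < V.card →
      5 ≤ (U.filter fun v => v i = c (a i)).card := by
    intro a ha hi h1 hlt
    refine ih _ hlt (polyboxCode_filter h.code _) (noTwinPair_filter h.noTwin _)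
      (w := Function.update a i (c (a i))) (fun B hB => ?_) (fun hm => ?_) rfl
    · obtain ⟨v, hv, hvi, hBv⟩ := h.cover_twin hinv hfix ha hi (fun v hv hvi =>
        Finset.card_le_one.1 h1 v (by simp [hv, hvi]) a (by simp [ha])) hB
      exact ⟨v, by simp [hv, hvi], hBv⟩
    · exact h.update_compl_notMem ha i (Finset.mem_filter.1 hm).1
  have s1 := step a ha hi
  have s2 := step b hb hbw
  rw [hbi, hinv] at s2
  have hall : ∀ v ∈ U, v i = a i ∨ v i = c (a i) := fun v hv =>
    eq_or_eq_compl_of_card_le hfix (by omega) hv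
  have := ih (U.filter fun v => v i = a i).card (by omega) (polyboxCode_filter h.code _)
    (noTwinPair_filter h.noTwin _) (w := Function.update w i (a i)) (fun B hB => by
      obtain ⟨v, hv, hvi, hBv⟩ := h.cover_update hinv hfix (h.compat a ha i) hall hB
      exact ⟨v, by simp [hv, hvi], hBv⟩) (fun hm => by
      have h1 : (U.filter fun v => v i = a i).card ≤ 1 := Finset.card_le_one.2 fun u hu v hv => by
        rw [Finset.mem_filter] at hu hv hm
        rw [h.eq_update_of_mem hfix hm.1 hu.1 hu.2, h.eq_update_of_mem hfix hm.1 hv.1 hv.2]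
      omega) rfl
  omega

namespace TightCover

theorem five_le_card_compl [Finite S] (h : TightCover c V w) (hinv : Function.Involutive c)
    (hfix : ∀ s, c s ≠ s) {a : Fin d → S} (ha : a ∈ V) {i : Fin d} (hi : a i ≠ w i)
    (h1 : (V.filter fun v => v i = a i).card ≤ 1) :
    5 ≤ (V.filter fun v => v i = c (a i)).card := by
  refine five_le_card hinv hfix (polyboxCode_filter h.code _) (noTwinPair_filter h.noTwin _)
    (w := Function.update a i (c (a i))) (fun B hB => ?_) (fun hm => ?_)
  · obtain ⟨v, hv, hvi, hBv⟩ := h.cover_twin hinv hfix ha hi (fun v hv hvi =>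
      Finset.card_le_one.1 h1 v (by simp [hv, hvi]) a (by simp [ha])) hB
    exact ⟨v, by simp [hv, hvi], hBv⟩
  · exact h.update_compl_notMem ha i (Finset.mem_filter.1 hm).1

/-- A letter and its complement at a position either both occur at least twice, or one of them
occurs once and the other at least five times. -/
theorem card_letter_cases [Finite S] (h : TightCover c V w) (hinv : Function.Involutive c)
    (hfix : ∀ s, c s ≠ s) {a : Fin d → S} (ha : a ∈ V) {i : Fin d} (hi : a i ≠ w i) :
    (2 ≤ (V.filter fun v => v i = a i).card ∧ 2 ≤ (V.filter fun v => v i = c (a i)).card) ∨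
    6 ≤ (V.filter fun v => v i = a i).card + (V.filter fun v => v i = c (a i)).card := by
  obtain ⟨b, hb, hbi, -⟩ := h.exists_compl hinv hfix ha hi
  have hpos : 0 < (V.filter fun v => v i = a i).card :=
    Finset.card_pos.2 ⟨a, by simp [ha]⟩
  have hpos' : 0 < (V.filter fun v => v i = c (a i)).card :=
    Finset.card_pos.2 ⟨b, by simp [hb, hbi]⟩
  have s1 := h.five_le_card_compl hinv hfix ha hi
  have s2 := h.five_le_card_compl hinv hfix hb (i := i) (hbi ▸ h.compl_ne hinv ha i)
  rw [hbi, hinv] at s2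
  omega

theorem five_le_card_letter [Finite S] (h : TightCover c V w) (hinv : Function.Involutive c)
    (hfix : ∀ s, c s ≠ s) {i : Fin d} {x : S} (hx : x ≠ c (w i))
    (hall : ∀ v ∈ V, v i = x ∨ v i = c x) (hmem : Function.update w i x ∉ V) :
    5 ≤ (V.filter fun v => v i = x).card :=
  five_le_card hinv hfix (polyboxCode_filter h.code _) (noTwinPair_filter h.noTwin _)
    (w := Function.update w i x) (fun B hB => by
      obtain ⟨v, hv, hvi, hBv⟩ := h.cover_update hinv hfix hx hall hB
      exact ⟨v, by simp [hv, hvi], hBv⟩) (fun hm => hmem (Finset.mem_filter.1 hm).1)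

theorem card_letter_eq_one (h : TightCover c V w) (hfix : ∀ s, c s ≠ s) {i : Fin d} {x : S}
    (hmem : Function.update w i x ∈ V) : (V.filter fun v => v i = x).card = 1 := by
  refine Finset.card_eq_one.2 ⟨Function.update w i x, ?_⟩
  ext v
  simp only [Finset.mem_filter, Finset.mem_singleton]
  refine ⟨fun hv => h.eq_update_of_mem hfix hmem hv.1 hv.2, ?_⟩
  rintro rfl
  simpa using hmem

/-- At most one pair of complementary letters, besides the letter of `w`, occurs at a given
position of a cover with at most seven words. -/
theorem letter_cases [Finite S] (h : TightCover c V w) (hinv : Function.Involutive c)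
    (hfix : ∀ s, c s ≠ s) (hcard : V.card ≤ 7) {a : Fin d → S} (ha : a ∈ V) {i : Fin d}
    (hi : a i ≠ w i) {v : Fin d → S} (hv : v ∈ V) :
    v i = a i ∨ v i = c (a i) ∨ v i = w i := by
  by_contra! hne
  obtain ⟨h1, h2, h3⟩ := hne
  have ca := h.card_letter_cases hinv hfix ha hi
  have cv := h.card_letter_cases hinv hfix hv h3
  have le : (V.filter fun u => u i = v i).card + (V.filter fun u => u i = c (v i)).card ≤
      (V.filter fun u => ¬ (u i = a i ∨ u i = c (a i))).card := by
    rw [← Finset.card_union_of_disjoint]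
    · refine Finset.card_le_card fun u hu => ?_
      have := hinv (v i)
      have := hinv (a i)
      simp only [Finset.mem_union, Finset.mem_filter] at hu ⊢
      grind
    · rw [Finset.disjoint_filter]
      intro u _ h1 h2
      exact hfix (v i) (h2.symm.trans h1)
  have eq := Finset.card_filter_add_card_filter_not (s := V)
    (fun u => u i = a i ∨ u i = c (a i))
  have le' : (V.filter fun u => u i = a i).card + (V.filter fun u => u i = c (a i)).card ≤
      (V.filter fun u => u i = a i ∨ u i = c (a i)).card := by
    rw [← Finset.card_union_of_disjoint, ← Finset.filter_or]
    rw [Finset.disjoint_filter]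
    intro u _ h1 h2
    exact hfix (a i) (h2.symm.trans h1)
  omega

/-- In a cover by five words, a letter other than that of `w` and its complement both occur
exactly twice at a given position. -/
theorem card_letter_eq_two [Finite S] (h : TightCover c V w) (hinv : Function.Involutive c)
    (hfix : ∀ s, c s ≠ s) (hcard : V.card = 5) {a : Fin d → S} (ha : a ∈ V) {i : Fin d}
    (hi : a i ≠ w i) :
    (V.filter fun v => v i = a i).card = 2 ∧ (V.filter fun v => v i = c (a i)).card = 2 := by
  have ca := h.card_letter_cases hinv hfix ha hi
  have le := card_filter_add_card_filter_compl_le hfix V i (a i)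
  by_contra hne
  have hall : ∀ v ∈ V, v i = a i ∨ v i = c (a i) := fun v hv =>
    eq_or_eq_compl_of_card_le hfix (by omega) hv
  have s1 := h.five_le_card_letter hinv hfix (h.compat a ha i) hall
  have s1' := h.card_letter_eq_one hfix (i := i) (x := a i)
  by_cases hm : Function.update w i (a i) ∈ V
  · have := s1' hm
    omega
  · have := s1 hm
    omega

/-- In a cover by six words none of which has the letter of `w` at position `i`, one of the words
differs from `w` only at `i`, and the remaining five carry the complementary letter there. -/
theorem exists_update_mem [Finite S] (h : TightCover c V w) (hinv : Function.Involutive c)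
    (hfix : ∀ s, c s ≠ s) (hcard : V.card = 6) {i : Fin d} (hi : ∀ v ∈ V, v i ≠ w i) :
    ∃ x, Function.update w i x ∈ V ∧ (V.filter fun v => v i = x).card = 1 ∧
      (V.filter fun v => v i = c x).card = 5 := by
  obtain ⟨a, ha⟩ := Finset.card_pos.1 (by omega : 0 < V.card)
  have hall : ∀ v ∈ V, v i = a i ∨ v i = c (a i) := fun v hv => by
    have := h.letter_cases hinv hfix (by omega) ha (hi a ha) hv
    have := hi v hv
    tauto
  have hsum : ∀ x, (∀ v ∈ V, v i = x ∨ v i = c x) →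
      (V.filter fun v => v i = x).card + (V.filter fun v => v i = c x).card = 6 := by
    intro x hx
    rw [← Finset.card_union_of_disjoint, ← Finset.filter_or, Finset.filter_true_of_mem hx, hcard]
    rw [Finset.disjoint_filter]
    intro u _ h1 h2
    exact hfix x (h2.symm.trans h1)
  have hall' : ∀ v ∈ V, v i = c (a i) ∨ v i = c (c (a i)) := fun v hv => by
    rw [hinv]
    exact (hall v hv).symm
  have hca : c (a i) ≠ c (w i) := fun e => hi a ha (hinv.injective e)
  have e1 := hsum _ hall
  have e2 := hsum _ hall'
  by_cases h1 : Function.update w i (a i) ∈ V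
  · have := h.card_letter_eq_one hfix h1
    exact ⟨a i, h1, this, by omega⟩
  by_cases h2 : Function.update w i (c (a i)) ∈ V
  · have := h.card_letter_eq_one hfix h2
    exact ⟨c (a i), h2, this, by omega⟩
  have := h.five_le_card_letter hinv hfix (h.compat a ha i) hall h1
  have := h.five_le_card_letter hinv hfix hca hall' h2
  omega

/-- In a cover by five words, some word with a letter different from that of `w` at position `j`
agrees with `w` at position `i ≠ j`. -/
theorem exists_eq_of_ne [Finite S] (h : TightCover c V w) (hinv : Function.Involutive c)
    (hfix : ∀ s, c s ≠ s) (hcard : V.card = 5) {a : Fin d → S} (ha : a ∈ V) {i j : Fin d}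
    (hij : i ≠ j) (hj : a j ≠ w j) : ∃ b ∈ V, b j ≠ w j ∧ b i = w i := by
  by_contra! hne
  have hai := hne a ha hj
  have hlet : ∀ v ∈ V, v j ≠ w j → v i = a i ∨ v i = c (a i) := fun v hv hvj => by
    have := h.letter_cases hinv hfix (by omega) ha hai hv
    have := hne v hv hvj
    tauto
  obtain ⟨b, hb, hbj, hbm⟩ := h.exists_compl hinv hfix ha hj
  have hbw : b j ≠ w j := hbj ▸ h.compl_ne hinv ha j
  have hbi : b i = a i := (hlet b hb hbw).resolve_right (hbm i hij)
  have hab : a ≠ b := fun e => hfix (a j) (by rw [← hbj, ← e])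
  have hpair : ({a, b} : Finset (Fin d → S)) = V.filter fun v => v i = a i := by
    refine Finset.eq_of_subset_of_card_le ?_ ?_
    · intro v hv
      simp only [Finset.mem_insert, Finset.mem_singleton] at hv
      rcases hv with rfl | rfl <;> simp [*]
    · rw [(h.card_letter_eq_two hinv hfix hcard ha hai).1, Finset.card_pair hab]
  have huniq : ∀ v ∈ V, v i = a i → v = a ∨ v = b := fun v hv hvi => by
    have : v ∈ ({a, b} : Finset (Fin d → S)) := by rw [hpair]; simp [hv, hvi]
    simpa using this
  refine h.noTwin a ha b hb ⟨j, hbj, fun k hk => ?_⟩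
  by_contra hkne
  by_cases hbk : b k = w k
  · obtain ⟨v, hv, hvj, hvk, hvm⟩ := h.exists_compl_ne hinv hfix hb hbw hk (Ne.symm hkne)
      (fun e => hkne (hbk.trans e.symm))
    rw [hbj, hinv] at hvj
    have hvi : v i = a i := (hlet v hv (hvj ▸ hj)).resolve_right (hbi ▸ hvm i hij)
    rcases huniq v hv hvi with rfl | rfl
    · exact hvk rfl
    · exact hfix (a j) (hbj.symm.trans hvj)
  · obtain ⟨v, hv, hvj, hvk, hvm⟩ := h.exists_compl_ne hinv hfix ha hj hk hkne hbk
    have hvi : v i = a i :=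
      (hlet v hv (hvj ▸ h.compl_ne hinv ha j)).resolve_right (hvm i hij)
    rcases huniq v hv hvi with rfl | rfl
    · exact hfix (v j) hvj.symm
    · exact hvk rfl

theorem card_ne_eq_four [Finite S] (h : TightCover c V w) (hinv : Function.Involutive c)
    (hfix : ∀ s, c s ≠ s) (hcard : V.card = 5) {a : Fin d → S} (ha : a ∈ V) {i : Fin d}
    (hi : a i ≠ w i) : (V.filter fun v => v i ≠ w i).card = 4 := by
  have h2 := h.card_letter_eq_two hinv hfix hcard ha hi
  have : (V.filter fun v => v i ≠ w i) = V.filter fun v => v i = a i ∨ v i = c (a i) := by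
    refine Finset.filter_congr fun v hv => ?_
    have := h.letter_cases hinv hfix (by omega) ha hi hv
    have := h.compl_ne hinv ha i
    grind
  rw [this, Finset.filter_or, Finset.card_union_of_disjoint, h2.1, h2.2]
  rw [Finset.disjoint_filter]
  intro u _ h1 h2
  exact hfix (a i) (h2.symm.trans h1)

end TightCover

end Card

theorem two_covered_words_card_ge_seven {d : ℕ} [Fintype S] (c : S → S)
    (hinv : Function.Involutive c) (hfix : ∀ s, c s ≠ s)
    (V : Set (Fin d → S)) (hV : PolyboxCode c V) (hVt : NoTwinPair c V)
    (w u : Fin d → S) (hwV : w ∉ V) (huV : u ∉ V)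
    (hcovw : Realize c w ⊆ RealizeSet c V)
    (hcovu : Realize c u ⊆ RealizeSet c V)
    (hdich : Dicho c w u) (htp : ¬ TwinPair c w u) :
    7 ≤ V.ncard := by
  classical
  by_contra! hlt
  obtain ⟨F, rfl⟩ : ∃ F : Finset (Fin d → S), V = F := ⟨V.toFinite.toFinset, by simp⟩
  rw [Set.ncard_coe_finset] at hlt
  have hcw : ∀ B ∈ Realize c w, ∃ v ∈ F, B ∈ Realize c v := fun B hB => by
    simpa [RealizeSet] using hcovw hB
  have hcu : ∀ B ∈ Realize c u, ∃ v ∈ F, B ∈ Realize c v := fun B hB => by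
    simpa [RealizeSet] using hcovu hB
  have hw := tightCover_filter hV hVt hcw hwV
  have hu := tightCover_filter hV hVt hcu huV
  set W := F.filter fun v => ∀ k, v k ≠ c (w k) with hW
  set U := F.filter fun v => ∀ k, v k ≠ c (u k) with hU
  have hWF : W ⊆ F := Finset.filter_subset _ _
  have hUF : U ⊆ F := Finset.filter_subset _ _
  have hW5 := five_le_card hinv hfix hw.code hw.noTwin hw.cover hw.notMem
  have hU5 := five_le_card hinv hfix hu.code hu.noTwin hu.cover hu.notMem
  have hun := Finset.card_le_card (Finset.union_subset hWF hUF)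
  have hinter := Finset.card_union_add_card_inter W U
  have hWle := Finset.card_le_card hWF
  have hUle := Finset.card_le_card hUF
  obtain ⟨j, hj⟩ := hdich
  have hIw : ∀ v ∈ W ∩ U, v j ≠ w j := fun v hv e =>
    hu.compat v (Finset.mem_inter.1 hv).2 j (by rw [e, hj, hinv])
  have hIu : ∀ v ∈ W ∩ U, v j ≠ u j := fun v hv e =>
    hw.compat v (Finset.mem_inter.1 hv).1 j (by rw [e, hj])
  obtain ⟨a, ha⟩ := Finset.card_pos.1 (by omega : 0 < (W ∩ U).card)
  have ha' := Finset.mem_inter.1 ha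
  have hIW : W ∩ U ⊆ W.filter fun v => v j ≠ w j := fun v hv =>
    Finset.mem_filter.2 ⟨(Finset.mem_inter.1 hv).1, hIw v hv⟩
  have hIU : W ∩ U ⊆ U.filter fun v => v j ≠ u j := fun v hv =>
    Finset.mem_filter.2 ⟨(Finset.mem_inter.1 hv).2, hIu v hv⟩
  have hIWle := Finset.card_le_card hIW
  have hIUle := Finset.card_le_card hIU
  have h4W := fun h => hw.card_ne_eq_four hinv hfix h ha'.1 (hIw a ha)
  have h4U := fun h => hu.card_ne_eq_four hinv hfix h ha'.2 (hIu a ha)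
  refine htp ⟨j, hj, fun i hij => ?_⟩
  by_cases h6 : W.card = 6
  · have hU6 : U.card = 6 := by
      by_contra hne
      have := h4U (by omega)
      omega
    have eW : W = F := Finset.eq_of_subset_of_card_le hWF (by omega)
    have eU : U = F := Finset.eq_of_subset_of_card_le hUF (by omega)
    rw [eW, eU] at hIw hIu
    rw [eW] at hw
    rw [eU] at hu
    rw [Finset.inter_self] at hIw hIu
    obtain ⟨x, hx, hx1, hx5⟩ := hw.exists_update_mem hinv hfix (by omega) hIw
    obtain ⟨y, hy, hy1, hy5⟩ := hu.exists_update_mem hinv hfix (by omega) hIu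
    have hyx := eq_or_eq_compl_of_card_le hfix (i := j) (x := x) (by omega) hy
    rw [Function.update_self] at hyx
    rcases hyx with rfl | rfl
    · have := congrFun (hw.eq_update_of_mem hfix hx hy (by simp)) i
      simpa [hij] using this
    · omega
  · have hW5' : W.card = 5 := by omega
    have hI4 := h4W hW5'
    have hU5' : U.card = 5 := by omega
    have hI4' := h4U hU5'
    have eIW := Finset.eq_of_subset_of_card_le hIW (by omega)
    have eIU := Finset.eq_of_subset_of_card_le hIU (by omega)
    obtain ⟨q, hq, hqj, hqi⟩ := hu.exists_eq_of_ne hinv hfix hU5' ha'.2 hij (hIu a ha)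
    have hqW : q ∈ W := (Finset.mem_inter.1 (eIU ▸ Finset.mem_filter.2 ⟨hq, hqj⟩)).1
    by_contra hne
    have h2 := (hw.card_letter_eq_two hinv hfix hW5' hqW (hqi ▸ hne)).2
    rw [hqi] at h2
    have hdisj : Disjoint (W ∩ U) (W.filter fun v => v i = c (u i)) := by
      rw [Finset.disjoint_left]
      intro v hv hv'
      exact hu.compat v (Finset.mem_inter.1 hv).2 i (Finset.mem_filter.1 hv').2
    have := Finset.card_le_card
      (Finset.union_subset (Finset.inter_subset_left (s₁ := W) (s₂ := U))
        (Finset.filter_subset (fun v => v i = c (u i)) W))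
    rw [Finset.card_union_of_disjoint hdisj] at this
    omega
end

section
/- Let S be a finite alphabet with a complementation, let d ≥ 3, and let V ⊆ (*S)^d be a partition code with exactly 5 words which does not contain a twin pair. Then there exist distinct indices i_1, i_2, i_3 ∈ {1,…,d} and letters l_1, l_2, l_3 ∈ S such that V = {v^1,…,v^5}, where the triples of letters of v^1,…,v^5 at the coordinates (i_1, i_2, i_3) are, respectively, (l_1, l_2, l_3), ((l_1)', (l_2)', (l_3)'), (*, (l_2)', l_3), (l_1, *, (l_3)'), ((l_1)', l_2, *), and every other coordinate of every word of V equals *. -/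
variable {S : Type}

/-- Words over `*S = S ∪ {*}` are modelled as `Fin d → Option S`, with `none = *`.
Two words are dichotomous: at some position one carries a letter `s ≠ *`
and the other its complement. -/
def DichoStar {d : ℕ} (c : S → S) (u v : Fin d → Option S) : Prop :=
  ∃ j, ∃ s, u j = some s ∧ v j = some (c s)

/-- Two words over `*S` form a twin pair. -/
def TwinPairStar {d : ℕ} (c : S → S) (u v : Fin d → Option S) : Prop :=
  ∃ j, (∃ s, u j = some s ∧ v j = some (c s)) ∧ ∀ i, i ≠ j → v i = u i

/-- A polybox code over `*S`: a set of pairwise dichotomous words. -/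
def PolyboxCodeStar {d : ℕ} (c : S → S) (V : Set (Fin d → Option S)) : Prop :=
  ∀ u ∈ V, ∀ v ∈ V, u ≠ v → DichoStar c u v

/-- The code contains no twin pair. -/
def NoTwinPairStar {d : ℕ} (c : S → S) (V : Set (Fin d → Option S)) : Prop :=
  ∀ u ∈ V, ∀ v ∈ V, ¬ TwinPairStar c u v

/-- `Es` for `s ∈ *S`; `E* = ES`. -/
def ELetterStar (c : S → S) : Option S → Set (Set S)
  | none => ESet c
  | some s => {B | B ∈ ESet c ∧ s ∈ B}

/-- The equicomplementary realization `v̌ ⊆ (ES)^d` of a word over `*S`. -/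
def RealizeStar {d : ℕ} (c : S → S) (v : Fin d → Option S) :
    Set (Fin d → Set S) :=
  {x | ∀ i, x i ∈ ELetterStar c (v i)}

/-- The union `⋃_{v ∈ V} v̌`. -/
def RealizeSetStar {d : ℕ} (c : S → S) (V : Set (Fin d → Option S)) :
    Set (Fin d → Set S) :=
  ⋃ v ∈ V, RealizeStar c v

/-- Two codes are equivalent if their realizations coincide. -/
def EquivCodesStar {d : ℕ} (c : S → S) (V W : Set (Fin d → Option S)) : Prop :=
  RealizeSetStar c V = RealizeSetStar c W

/-- A partition code: a polybox code whose realization is the whole box `(ES)^d`. -/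
def PartitionCodeStar {d : ℕ} (c : S → S) (U : Set (Fin d → Option S)) : Prop :=
  PolyboxCodeStar c U ∧ RealizeSetStar c U = {x | ∀ i, x i ∈ ESet c}

/-! ### Partitions of subcubes of the Boolean cube -/

namespace BoolCube

variable {X : Type}

/-- The point `p` lies in the subcube described by the partial assignment `w`. -/
def Agree (p : X → Bool) (w : X → Option Bool) : Prop :=
  ∀ x b, w x = some b → p x = b

/-- Two partial assignments disagree on some variable. -/
def Clash (u v : X → Option Bool) : Prop :=
  ∃ x b, u x = some b ∧ v x = some (!b)

/-- Two partial assignments differ exactly by the value of one variable. -/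
def Twin (u v : X → Option Bool) : Prop :=
  ∃ x b, (u x = some b ∧ v x = some (!b)) ∧ ∀ y, y ≠ x → v y = u y

/-- The subcubes in `F` partition the subcube `w`. -/
structure IsPartition (F : Finset (X → Option Bool)) (w : X → Option Bool) : Prop where
  clash : ∀ u ∈ F, ∀ v ∈ F, u ≠ v → Clash u v
  sub : ∀ u ∈ F, ∀ x b, w x = some b → u x = some b
  cover : ∀ p, Agree p w → ∃ u ∈ F, Agree p u

/-- The members of `F` with prescribed value at the variable `x`. -/
def slice [DecidableEq X] (F : Finset (X → Option Bool)) (x : X) (o : Option Bool) :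
    Finset (X → Option Bool) :=
  F.filter (fun v => v x = o)

theorem exists_agree (w : X → Option Bool) : ∃ p, Agree p w :=
  ⟨fun x => (w x).getD true, fun x b h => by simp [h]⟩

theorem exists_agree_with_value [DecidableEq X] {w : X → Option Bool} {y : X} {e : Bool}
    (h : w y ≠ some (!e)) : ∃ p, Agree p w ∧ p y = e := by
  refine ⟨Function.update (fun x => (w x).getD true) y e, fun x b hb => ?_, by simp⟩
  by_cases hx : x = y
  · subst hx
    cases b <;> cases e <;> simp_all
  · simp [hx, hb]

theorem Clash.not_agree {u v : X → Option Bool} (h : Clash u v) {p : X → Bool}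
    (hu : Agree p u) (hv : Agree p v) : False := by
  obtain ⟨x, b, h1, h2⟩ := h
  have e1 := hu x b h1
  have e2 := hv x _ h2
  cases b <;> simp_all

theorem agree_update_of_none [DecidableEq X] {p : X → Bool} {w : X → Option Bool} {x : X}
    (hx : w x = none) (b : Bool) (h : Agree p w) : Agree (Function.update p x b) w := by
  intro y e hy
  have hyx : y ≠ x := by rintro rfl; simp_all
  simpa [hyx] using h y e hy

theorem agree_of_agree_update [DecidableEq X] {p : X → Bool} {w : X → Option Bool} {x : X}
    (hx : w x = none) {b : Bool} (h : Agree (Function.update p x b) w) : Agree p w := by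
  simpa using agree_update_of_none hx (p x) h

namespace IsPartition

variable {F : Finset (X → Option Bool)} {w : X → Option Bool}

theorem eq_of_agree (hF : IsPartition F w) {u v : X → Option Bool} (hu : u ∈ F) (hv : v ∈ F)
    {p : X → Bool} (hpu : Agree p u) (hpv : Agree p v) : u = v := by
  by_contra h
  exact (hF.clash u hu v hv h).not_agree hpu hpv

theorem agree_of_mem (hF : IsPartition F w) {u : X → Option Bool} (hu : u ∈ F)
    {p : X → Bool} (hp : Agree p u) : Agree p w :=
  fun x b h => hp x b (hF.sub u hu x b h)

theorem eq_of_singleton {v : X → Option Bool} (h : IsPartition {v} w) : v = w := by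
  classical
  funext y
  cases hw : w y with
  | some b => exact h.sub v (by simp) y b hw
  | none =>
    cases hv : v y with
    | none => rfl
    | some b =>
      obtain ⟨p, hp, hpy⟩ := exists_agree_with_value (w := w) (y := y) (e := !b) (by simp [hw])
      obtain ⟨u, hu, hpu⟩ := h.cover p hp
      rw [Finset.mem_singleton] at hu
      subst hu
      have := hpu y b hv
      cases b <;> simp_all

variable [DecidableEq X]

/-- Flipping the variable `x` moves points covered by `slice F x (some b)` into the
opposite slice. -/
theorem exists_mem_slice_not (hF : IsPartition F w) {x : X} (hx : w x = none) {b : Bool}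
    {u : X → Option Bool} (hu : u ∈ slice F x (some b)) {p : X → Bool} (hp : Agree p u) :
    ∃ v ∈ slice F x (some (!b)), Agree (Function.update p x (!b)) v := by
  obtain ⟨huF, hux⟩ := Finset.mem_filter.1 hu
  obtain ⟨v, hv, hpv⟩ := hF.cover _ (agree_update_of_none hx (!b) (hF.agree_of_mem huF hp))
  refine ⟨v, Finset.mem_filter.2 ⟨hv, ?_⟩, hpv⟩
  cases hvx : v x with
  | none =>
    have := hF.eq_of_agree huF hv hp (agree_of_agree_update hvx hpv)
    simp_all
  | some e =>
    have := hpv x e hvx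
    simp_all

theorem slice_not_of_slice_eq_singleton (hF : IsPartition F w) {x : X} (hx : w x = none)
    {b : Bool} {u : X → Option Bool} (hu : slice F x (some b) = {u}) :
    IsPartition (slice F x (some (!b))) (Function.update u x (some (!b))) := by
  have huS : u ∈ slice F x (some b) := by simp [hu]
  have hux : u x = some b := (Finset.mem_filter.1 huS).2
  refine ⟨fun v hv v' hv' => hF.clash v (Finset.mem_filter.1 hv).1 v' (Finset.mem_filter.1 hv').1,
    fun v hv y e hy => ?_, fun p hp => ?_⟩
  · by_cases hyx : y = x
    · subst hyx
      simp only [Function.update_self] at hy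
      rw [(Finset.mem_filter.1 hv).2, hy]
    · rw [Function.update_of_ne hyx] at hy
      by_contra hne
      obtain ⟨p, hp, hpy⟩ := exists_agree_with_value (w := v) (y := y) (e := !e) (by simpa using hne)
      obtain ⟨u', hu', hpu'⟩ := hF.exists_mem_slice_not hx hv hp
      rw [Bool.not_not, hu, Finset.mem_singleton] at hu'
      subst hu'
      have := hpu' y e hy
      rw [Function.update_of_ne hyx] at this
      cases e <;> simp_all
  · have hpx : p x = !b := hp x _ (by simp)
    have hp' : Agree (Function.update p x b) u := by
      intro y e hy
      by_cases hyx : y = x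
      · subst hyx
        simp_all
      · rw [Function.update_of_ne hyx]
        exact hp y e (by rwa [Function.update_of_ne hyx])
    obtain ⟨v, hv, hpv⟩ := hF.exists_mem_slice_not hx huS hp'
    refine ⟨v, hv, ?_⟩
    rwa [Function.update_idem, ← hpx, Function.update_eq_self] at hpv

theorem slice_of_slice_none_eq_empty (hF : IsPartition F w) {x : X} (hx : w x = none)
    (h : slice F x none = ∅) (b : Bool) :
    IsPartition (slice F x (some b)) (Function.update w x (some b)) := by
  refine ⟨fun v hv v' hv' => hF.clash v (Finset.mem_filter.1 hv).1 v' (Finset.mem_filter.1 hv').1,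
    fun v hv y e hy => ?_, fun p hp => ?_⟩
  · by_cases hyx : y = x
    · subst hyx
      simp only [Function.update_self] at hy
      rw [(Finset.mem_filter.1 hv).2, hy]
    · rw [Function.update_of_ne hyx] at hy
      exact hF.sub v (Finset.mem_filter.1 hv).1 y e hy
  · have hpw : Agree p w := by
      intro y e hy
      have hyx : y ≠ x := by rintro rfl; simp_all
      exact hp y e (by rwa [Function.update_of_ne hyx])
    obtain ⟨v, hv, hpv⟩ := hF.cover p hpw
    refine ⟨v, Finset.mem_filter.2 ⟨hv, ?_⟩, hpv⟩
    have hpx : p x = b := hp x b (by simp)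
    cases hvx : v x with
    | none =>
      have : v ∈ slice F x none := Finset.mem_filter.2 ⟨hv, hvx⟩
      simp [h] at this
    | some e => rw [← hpx, hpv x e hvx]

theorem card_slices (F : Finset (X → Option Bool)) (x : X) (b : Bool) :
    (slice F x (some b)).card + (slice F x (some (!b))).card + (slice F x none).card = F.card := by
  have h := Finset.card_eq_sum_card_fiberwise (s := F) (f := fun v => v x)
    (t := Finset.univ) (by simp)
  simp only [Fintype.sum_option, Fintype.sum_bool] at h
  unfold slice
  cases b <;> simp only [Bool.not_true, Bool.not_false] <;> omega

/-- If smaller twin-free partitions are trivial, then a variable used in a twin-free partition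
occurs at least twice with each sign and is missed at least once. -/
theorem card_slice_le (hF : IsPartition F w) (htw : ∀ u ∈ F, ∀ v ∈ F, ¬ Twin u v)
    (IH : ∀ G w', G ⊆ F → G.card < F.card → IsPartition G w' → G.card ≤ 1)
    {x : X} (hx : w x = none) {b : Bool} (hne : (slice F x (some b)).Nonempty) :
    2 ≤ (slice F x (some b)).card ∧ 2 ≤ (slice F x (some (!b))).card ∧
      1 ≤ (slice F x none).card := by
  have key : ∀ b, (slice F x (some b)).Nonempty → 2 ≤ (slice F x (some b)).card ∧
      (slice F x (some (!b))).Nonempty := by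
    intro b hne
    obtain ⟨u, hu⟩ := hne
    obtain ⟨p, hp⟩ := exists_agree u
    obtain ⟨v, hv, -⟩ := hF.exists_mem_slice_not hx hu hp
    refine ⟨?_, v, hv⟩
    by_contra hlt
    have h0 : 0 < (slice F x (some b)).card := Finset.card_pos.2 ⟨u, hu⟩
    obtain ⟨u', hu'⟩ := Finset.card_eq_one.1 (show (slice F x (some b)).card = 1 by omega)
    have huu : u = u' := by rwa [hu', Finset.mem_singleton] at hu
    subst huu
    have hP := hF.slice_not_of_slice_eq_singleton hx hu'
    have hc := IH (slice F x (some (!b))) _ (Finset.filter_subset _ _)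
      (show (slice F x (some (!b))).card < F.card by have := card_slices F x b; omega) hP
    obtain ⟨v', hv'⟩ := Finset.card_eq_one.1
      (le_antisymm hc (Finset.card_pos.2 ⟨v, hv⟩))
    have hvv : v = v' := by rwa [hv', Finset.mem_singleton] at hv
    subst hvv
    rw [hv'] at hP
    have hEq := hP.eq_of_singleton
    refine htw u (Finset.mem_filter.1 hu).1 v (Finset.mem_filter.1 hv).1
      ⟨x, b, ⟨(Finset.mem_filter.1 hu).2, (Finset.mem_filter.1 hv).2⟩, fun y hy => ?_⟩
    rw [hEq, Function.update_of_ne hy]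
  obtain ⟨h1, h2⟩ := key b hne
  obtain ⟨h3, -⟩ := key _ h2
  refine ⟨h1, h3, ?_⟩
  by_contra h0
  have h0' : slice F x none = ∅ := Finset.card_eq_zero.1 (by omega)
  have := IH (slice F x (some b)) _ (Finset.filter_subset _ _)
    (show (slice F x (some b)).card < F.card by have := card_slices F x b; omega)
    (hF.slice_of_slice_none_eq_empty hx h0' b)
  omega

theorem exists_used (hF : IsPartition F w) (h : 1 < F.card) :
    ∃ x, w x = none ∧ ∃ b, (slice F x (some b)).Nonempty := by
  obtain ⟨u, hu, v, hv, huv⟩ := Finset.one_lt_card.1 h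
  obtain ⟨x, b, h1, h2⟩ := hF.clash u hu v hv huv
  refine ⟨x, ?_, b, u, Finset.mem_filter.2 ⟨hu, h1⟩⟩
  cases hw : w x with
  | none => rfl
  | some e =>
    have := hF.sub u hu x e hw
    have := hF.sub v hv x e hw
    cases b <;> simp_all

theorem card_le_one (n : ℕ) : ∀ (F : Finset (X → Option Bool)) (w : X → Option Bool),
    F.card = n → n ≤ 4 → IsPartition F w → (∀ u ∈ F, ∀ v ∈ F, ¬ Twin u v) → F.card ≤ 1 := by
  induction n using Nat.strong_induction_on with
  | _ n ih =>
    intro F w hn h4 hF htw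
    by_contra hlt
    obtain ⟨x, hx, b, hne⟩ := hF.exists_used (by omega)
    have h := hF.card_slice_le htw (fun G w' hGF hG hP => ih G.card (by omega) G w' rfl (by omega) hP
      fun u hu v hv => htw u (hGF hu) v (hGF hv)) hx hne
    have := card_slices F x b
    omega

theorem card_slice_eq (hF : IsPartition F w) (htw : ∀ u ∈ F, ∀ v ∈ F, ¬ Twin u v)
    (h5 : F.card = 5) {x : X} (hx : w x = none) {b : Bool} (hne : (slice F x (some b)).Nonempty) :
    (slice F x none).card = 1 := by
  have h := hF.card_slice_le htw (fun G w' hGF hG hP => card_le_one G.card G w' rfl (by omega) hP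
    fun u hu v hv => htw u (hGF hu) v (hGF hv)) hx hne
  have := card_slices F x b
  omega

end IsPartition

theorem card_agree [Fintype X] [DecidableEq X] (w : X → Option Bool)
    [DecidablePred fun p => Agree p w] :
    (Finset.univ.filter fun p : X → Bool => Agree p w).card =
      2 ^ (Finset.univ.filter fun x => w x = none).card := by
  have : (Finset.univ.filter fun p : X → Bool => Agree p w) =
      Fintype.piFinset fun x => (w x).elim Finset.univ fun b => {b} := by
    ext p
    rw [Finset.mem_filter_univ, Fintype.mem_piFinset]
    refine forall_congr' fun x => ?_
    cases w x <;> simp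
  rw [this, Fintype.card_piFinset, ← Finset.prod_const, Finset.prod_filter]
  refine Finset.prod_congr rfl fun x _ => ?_
  cases w x <;> simp

theorem IsPartition.sum_card [Fintype X] [DecidableEq X] {F : Finset (X → Option Bool)}
    (hF : IsPartition F fun _ => none) :
    ∑ v ∈ F, 2 ^ (Finset.univ.filter fun x => v x = none).card = 2 ^ Fintype.card X := by
  classical
  have hU : (Finset.univ : Finset (X → Bool)) =
      F.biUnion fun v => Finset.univ.filter fun p => Agree p v := by
    ext p
    simpa using hF.cover p (by simp [Agree])
  have hc := congrArg Finset.card hU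
  rw [Finset.card_biUnion] at hc
  · simpa [card_agree] using hc.symm
  · intro u hu v hv huv
    refine Finset.disjoint_left.2 ?_
    intro p hp hp'
    exact (hF.clash u hu v hv huv).not_agree (Finset.mem_filter.1 hp).2 (Finset.mem_filter.1 hp').2

theorem two_pow_add_le (a b : ℕ) : 2 ^ a + 2 ^ b ≤ 2 ^ (a + b) + 1 := by
  have ha : 1 ≤ 2 ^ a := Nat.one_le_two_pow
  have hb : 1 ≤ 2 ^ b := Nat.one_le_two_pow
  rw [pow_add]
  nlinarith [mul_nonneg (sub_nonneg.2 (show (1 : ℤ) ≤ 2 ^ a by exact_mod_cast ha))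
      (sub_nonneg.2 (show (1 : ℤ) ≤ 2 ^ b by exact_mod_cast hb))]

theorem exponents_of_five {n a b c d e : ℕ} (hs : a + b + c + d + e = n)
    (hp : 2 ^ a + 2 ^ b + 2 ^ c + 2 ^ d + 2 ^ e = 2 ^ n)
    (ha : a < n) (hb : b < n) (hc : c < n) (hd : d < n) (he : e < n) :
    n = 3 ∧ a ≤ 1 ∧ b ≤ 1 ∧ c ≤ 1 ∧ d ≤ 1 ∧ e ≤ 1 := by
  have key : ∀ a m, a + m = n → 1 ≤ a → a < n → 2 ^ n ≤ 2 ^ a + 2 ^ m + 3 → n ≤ 3 := by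
    intro a m ham h1 h2 h
    obtain ⟨a, rfl⟩ := Nat.exists_eq_add_of_le' h1
    obtain ⟨m, rfl⟩ := Nat.exists_eq_add_of_le' (show 1 ≤ m by omega)
    have h3 := two_pow_add_le a m
    rw [show n = (a + m) + 2 by omega] at h ⊢
    simp only [pow_succ] at h
    by_contra hh
    have : 2 ^ 2 ≤ 2 ^ (a + m) := Nat.pow_le_pow_right (by norm_num) (by omega)
    omega
  have four : ∀ a b c d : ℕ, 2 ^ a + 2 ^ b + 2 ^ c + 2 ^ d ≤ 2 ^ (a + b + c + d) + 3 := by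
    intro a b c d
    have := two_pow_add_le a b
    have := two_pow_add_le (a + b) c
    have := two_pow_add_le (a + b + c) d
    omega
  have hn : n ≤ 3 := by
    rcases Nat.eq_zero_or_pos a with h0 | h0
    · rcases Nat.eq_zero_or_pos b with h1 | h1
      · rcases Nat.eq_zero_or_pos c with h2 | h2
        · subst h0 h1 h2
          rcases Nat.eq_zero_or_pos d with h3 | h3
          · omega
          · exact key d e (by omega) h3 hd (by omega)
        · exact key c (a + b + d + e) (by omega) h2 hc (by have := four a b d e; omega)
      · exact key b (a + c + d + e) (by omega) h1 hb (by have := four a c d e; omega)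
    · exact key a (b + c + d + e) (by omega) h0 ha (by have := four b c d e; omega)
  have : a ≤ 2 := by omega
  have : b ≤ 2 := by omega
  have : c ≤ 2 := by omega
  have : d ≤ 2 := by omega
  have : e ≤ 2 := by omega
  subst hs
  interval_cases a <;> interval_cases b <;> interval_cases c <;> interval_cases d <;>
    interval_cases e <;> simp_all

theorem exponents_of_card_five {α : Type*} {F : Finset α} (h5 : F.card = 5) {m : α → ℕ} {n : ℕ}
    (hs : ∑ v ∈ F, m v = n) (hp : ∑ v ∈ F, 2 ^ m v = 2 ^ n) (hlt : ∀ v ∈ F, m v < n) :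
    n = 3 ∧ ∀ v ∈ F, m v ≤ 1 := by
  let e := (F.equivFinOfCardEq h5).symm
  rw [← Finset.sum_coe_sort, ← e.sum_comp, Fin.sum_univ_five] at hs hp
  have h := exponents_of_five hs hp (hlt _ (e 0).2) (hlt _ (e 1).2) (hlt _ (e 2).2)
    (hlt _ (e 3).2) (hlt _ (e 4).2)
  refine ⟨h.1, fun v hv => ?_⟩
  obtain ⟨i, hi⟩ := e.surjective ⟨v, hv⟩
  have hv' : v = e i := by rw [hi]
  rw [hv']
  fin_cases i
  exacts [h.2.1, h.2.2.1, h.2.2.2.1, h.2.2.2.2.1, h.2.2.2.2.2]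

/-- A twin-free partition into five subcubes uses three variables, and each of these is missed
by its own member of the partition. -/
theorem IsPartition.exists_three_variables [Fintype X] [DecidableEq X]
    {F : Finset (X → Option Bool)}
    (hF : IsPartition F fun _ => none) (htw : ∀ u ∈ F, ∀ v ∈ F, ¬ Twin u v) (h5 : F.card = 5) :
    ∃ U : Finset X, U.card = 3 ∧ (∀ x ∉ U, ∀ v ∈ F, v x = none) ∧
      (∀ x ∈ U, (slice F x none).card = 1) ∧
      ∀ v ∈ F, ∀ x ∈ U, ∀ y ∈ U, v x = none → v y = none → x = y := by
  classical
  let U : Finset X := Finset.univ.filter fun x => ∃ v ∈ F, v x ≠ none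
  have hU : ∀ x ∉ U, ∀ v ∈ F, v x = none := by
    intro x hx v hv
    by_contra h
    exact hx (Finset.mem_filter.2 ⟨Finset.mem_univ _, v, hv, h⟩)
  have h1 : ∀ x ∈ U, (slice F x none).card = 1 := by
    intro x hx
    obtain ⟨v, hv, hvx⟩ := (Finset.mem_filter.1 hx).2
    obtain ⟨b, hb⟩ := Option.ne_none_iff_exists'.1 hvx
    exact hF.card_slice_eq htw h5 rfl ⟨v, Finset.mem_filter.2 ⟨hv, hb⟩⟩
  let m : (X → Option Bool) → ℕ := fun v => (U.filter fun x => v x = none).card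
  have hs : ∑ v ∈ F, m v = U.card := by
    have := Finset.sum_card_bipartiteAbove_eq_sum_card_bipartiteBelow (s := F) (t := U)
      (fun v x => v x = none)
    refine this.trans ?_
    rw [Finset.card_eq_sum_ones]
    exact Finset.sum_congr rfl h1
  have hp : ∑ v ∈ F, 2 ^ m v = 2 ^ U.card := by
    have h := hF.sum_card
    have hc : Fintype.card X = U.card + Uᶜ.card := by simp
    have hm : ∀ v ∈ F, (Finset.univ.filter fun x => v x = none).card = m v + Uᶜ.card := by
      intro v hv
      rw [← Finset.card_union_of_disjoint]
      · congr 1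
        ext x
        simp only [Finset.mem_filter, Finset.mem_univ, true_and, Finset.mem_union,
          Finset.mem_compl]
        by_cases hx : x ∈ U
        · simp [hx]
        · simp [hx, hU x hx v hv]
      · rw [Finset.disjoint_left]
        intro x hx
        simpa using (Finset.mem_filter.1 hx).1
    rw [Finset.sum_congr rfl fun v hv => by rw [hm v hv, pow_add], ← Finset.sum_mul, hc,
      pow_add] at h
    exact Nat.eq_of_mul_eq_mul_right (by positivity) h
  have hlt : ∀ v ∈ F, m v < U.card := by
    intro v hv
    refine Finset.card_lt_card (Finset.filter_ssubset.2 ?_)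
    obtain ⟨u, hu, huv⟩ := Finset.exists_mem_ne (show 1 < F.card by omega) v
    obtain ⟨x, b, h, -⟩ := hF.clash v hv u hu huv.symm
    exact ⟨x, Finset.mem_filter.2 ⟨Finset.mem_univ _, v, hv, by simp [h]⟩, by simp [h]⟩
  obtain ⟨h3, hm⟩ := exponents_of_card_five h5 hs hp hlt
  exact ⟨U, h3, hU, h1, fun v hv x hx y hy hvx hvy => Finset.card_le_one.1 (hm v hv) x
    (Finset.mem_filter.2 ⟨hx, hvx⟩) y (Finset.mem_filter.2 ⟨hy, hvy⟩)⟩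

theorem bits_of_clashes {p₁ p₂ p₃ q₁ q₂ q₃ a₂ a₃ b₁ b₃ c₁ c₂ : Bool}
    (hPQ : p₁ ≠ q₁ ∨ p₂ ≠ q₂ ∨ p₃ ≠ q₃)
    (hPA : p₂ ≠ a₂ ∨ p₃ ≠ a₃) (hPB : p₁ ≠ b₁ ∨ p₃ ≠ b₃) (hPC : p₁ ≠ c₁ ∨ p₂ ≠ c₂)
    (hQA : q₂ ≠ a₂ ∨ q₃ ≠ a₃) (hQB : q₁ ≠ b₁ ∨ q₃ ≠ b₃) (hQC : q₁ ≠ c₁ ∨ q₂ ≠ c₂)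
    (hAB : a₃ ≠ b₃) (hAC : a₂ ≠ c₂) (hBC : b₁ ≠ c₁) :
    a₂ = (!c₂) ∧ b₁ = (!c₁) ∧ b₃ = (!a₃) ∧
      ((p₁ = b₁ ∧ p₂ = c₂ ∧ p₃ = a₃ ∧ q₁ = c₁ ∧ q₂ = a₂ ∧ q₃ = b₃) ∨
        (q₁ = b₁ ∧ q₂ = c₂ ∧ q₃ = a₃ ∧ p₁ = c₁ ∧ p₂ = a₂ ∧ p₃ = b₃)) := by
  cases c₂ <;> cases a₂ <;> simp at hAC <;> cases c₁ <;> cases b₁ <;> simp at hBC <;>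
    cases a₃ <;> cases b₃ <;> simp at hAB <;> simp at * <;> grind

/-- The structure of twin-free partitions of the Boolean cube into five subcubes. -/
theorem IsPartition.eq_five [Fintype X] [DecidableEq X] {F : Finset (X → Option Bool)}
    (hF : IsPartition F fun _ => none) (htw : ∀ u ∈ F, ∀ v ∈ F, ¬ Twin u v) (h5 : F.card = 5) :
    ∃ (x₁ x₂ x₃ : X) (l₁ l₂ l₃ : Bool) (v₁ v₂ v₃ v₄ v₅ : X → Option Bool),
      (x₁ ≠ x₂ ∧ x₁ ≠ x₃ ∧ x₂ ≠ x₃) ∧ F = {v₁, v₂, v₃, v₄, v₅} ∧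
      (v₁ x₁ = some l₁ ∧ v₁ x₂ = some l₂ ∧ v₁ x₃ = some l₃) ∧
      (v₂ x₁ = some (!l₁) ∧ v₂ x₂ = some (!l₂) ∧ v₂ x₃ = some (!l₃)) ∧
      (v₃ x₁ = none ∧ v₃ x₂ = some (!l₂) ∧ v₃ x₃ = some l₃) ∧
      (v₄ x₁ = some l₁ ∧ v₄ x₂ = none ∧ v₄ x₃ = some (!l₃)) ∧
      (v₅ x₁ = some (!l₁) ∧ v₅ x₂ = some l₂ ∧ v₅ x₃ = none) ∧
      ∀ v ∈ F, ∀ y, y ≠ x₁ → y ≠ x₂ → y ≠ x₃ → v y = none := by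
  classical
  obtain ⟨U, hU3, hU, h1, hinj⟩ := hF.exists_three_variables htw h5
  obtain ⟨x₁, x₂, x₃, h12, h13, h23, rfl⟩ := Finset.card_eq_three.1 hU3
  have hmiss : ∀ x ∈ ({x₁, x₂, x₃} : Finset X), ∃ A ∈ F, A x = none ∧
      ∀ v ∈ F, v ≠ A → v x ≠ none := by
    intro x hx
    obtain ⟨A, hA⟩ := Finset.card_eq_one.1 (h1 x hx)
    have hAm : A ∈ slice F x none := by simp [hA]
    refine ⟨A, (Finset.mem_filter.1 hAm).1, (Finset.mem_filter.1 hAm).2, fun v hv hne h => hne ?_⟩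
    have : v ∈ slice F x none := Finset.mem_filter.2 ⟨hv, h⟩
    simpa [hA] using this
  obtain ⟨A, hA, hA1, hA'⟩ := hmiss x₁ (by simp)
  obtain ⟨B, hB, hB2, hB'⟩ := hmiss x₂ (by simp)
  obtain ⟨C, hC, hC3, hC'⟩ := hmiss x₃ (by simp)
  have hAB : A ≠ B := by
    rintro rfl
    exact h12 (hinj A hA _ (by simp) _ (by simp) hA1 hB2)
  have hAC : A ≠ C := by
    rintro rfl
    exact h13 (hinj A hA _ (by simp) _ (by simp) hA1 hC3)
  have hBC : B ≠ C := by
    rintro rfl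
    exact h23 (hinj B hB _ (by simp) _ (by simp) hB2 hC3)
  have hsub : ({A, B, C} : Finset _) ⊆ F := by
    intro v
    simp only [Finset.mem_insert, Finset.mem_singleton]
    rintro (rfl | rfl | rfl) <;> assumption
  have hcard : (F \ {A, B, C}).card = 2 := by
    rw [Finset.card_sdiff_of_subset hsub, h5, Finset.card_eq_three.2 ⟨A, B, C, hAB, hAC, hBC, rfl⟩]
  obtain ⟨P, Q, hPQ, hPQF⟩ := Finset.card_eq_two.1 hcard
  have hFeq : F = {P, Q, A, B, C} := by
    rw [← Finset.sdiff_union_of_subset hsub, hPQF]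
    ext v
    simp
    tauto
  have hPm : P ∈ F \ {A, B, C} := by simp [hPQF]
  have hQm : Q ∈ F \ {A, B, C} := by simp [hPQF]
  simp only [Finset.mem_sdiff, Finset.mem_insert, Finset.mem_singleton, not_or] at hPm hQm
  obtain ⟨hP, hPA, hPB, hPC⟩ := hPm
  obtain ⟨hQ, hQA, hQB, hQC⟩ := hQm
  obtain ⟨p₁, hp₁⟩ := Option.ne_none_iff_exists'.1 (hA' P hP hPA)
  obtain ⟨p₂, hp₂⟩ := Option.ne_none_iff_exists'.1 (hB' P hP hPB)
  obtain ⟨p₃, hp₃⟩ := Option.ne_none_iff_exists'.1 (hC' P hP hPC)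
  obtain ⟨q₁, hq₁⟩ := Option.ne_none_iff_exists'.1 (hA' Q hQ hQA)
  obtain ⟨q₂, hq₂⟩ := Option.ne_none_iff_exists'.1 (hB' Q hQ hQB)
  obtain ⟨q₃, hq₃⟩ := Option.ne_none_iff_exists'.1 (hC' Q hQ hQC)
  obtain ⟨a₂, ha₂⟩ := Option.ne_none_iff_exists'.1 (hB' A hA hAB)
  obtain ⟨a₃, ha₃⟩ := Option.ne_none_iff_exists'.1 (hC' A hA hAC)
  obtain ⟨b₁, hb₁⟩ := Option.ne_none_iff_exists'.1 (hA' B hB hAB.symm)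
  obtain ⟨b₃, hb₃⟩ := Option.ne_none_iff_exists'.1 (hC' B hB hBC)
  obtain ⟨c₁, hc₁⟩ := Option.ne_none_iff_exists'.1 (hA' C hC hAC.symm)
  obtain ⟨c₂, hc₂⟩ := Option.ne_none_iff_exists'.1 (hB' C hC hBC.symm)
  have hcl : ∀ u ∈ F, ∀ v ∈ F, u ≠ v → (u x₁ ≠ v x₁ ∧ u x₁ ≠ none ∧ v x₁ ≠ none) ∨
      (u x₂ ≠ v x₂ ∧ u x₂ ≠ none ∧ v x₂ ≠ none) ∨ (u x₃ ≠ v x₃ ∧ u x₃ ≠ none ∧ v x₃ ≠ none) := by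
    intro u hu v hv huv
    obtain ⟨x, b, h, h'⟩ := hF.clash u hu v hv huv
    have hx : x ∈ ({x₁, x₂, x₃} : Finset X) := by
      by_contra hx
      rw [hU x hx u hu] at h
      cases h
    have hne : u x ≠ v x ∧ u x ≠ none ∧ v x ≠ none := by simp [h, h']
    simp only [Finset.mem_insert, Finset.mem_singleton] at hx
    rcases hx with rfl | rfl | rfl
    exacts [.inl hne, .inr (.inl hne), .inr (.inr hne)]
  obtain ⟨e₂, e₁, e₃, hbits⟩ := bits_of_clashes
    (p₁ := p₁) (p₂ := p₂) (p₃ := p₃) (q₁ := q₁) (q₂ := q₂) (q₃ := q₃)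
    (a₂ := a₂) (a₃ := a₃) (b₁ := b₁) (b₃ := b₃) (c₁ := c₁) (c₂ := c₂)
    (by simpa [hp₁, hp₂, hp₃, hq₁, hq₂, hq₃] using hcl P hP Q hQ hPQ)
    (by simpa [hp₁, hp₂, hp₃, hA1, ha₂, ha₃] using hcl P hP A hA hPA)
    (by simpa [hp₁, hp₂, hp₃, hb₁, hB2, hb₃] using hcl P hP B hB hPB)
    (by simpa [hp₁, hp₂, hp₃, hc₁, hc₂, hC3] using hcl P hP C hC hPC)
    (by simpa [hq₁, hq₂, hq₃, hA1, ha₂, ha₃] using hcl Q hQ A hA hQA)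
    (by simpa [hq₁, hq₂, hq₃, hb₁, hB2, hb₃] using hcl Q hQ B hB hQB)
    (by simpa [hq₁, hq₂, hq₃, hc₁, hc₂, hC3] using hcl Q hQ C hC hQC)
    (by simpa [hA1, ha₂, ha₃, hb₁, hB2, hb₃] using hcl A hA B hB hAB)
    (by simpa [hA1, ha₂, ha₃, hc₁, hc₂, hC3] using hcl A hA C hC hAC)
    (by simpa [hb₁, hB2, hb₃, hc₁, hc₂, hC3] using hcl B hB C hC hBC)
  have hrest : ∀ v ∈ F, ∀ y, y ≠ x₁ → y ≠ x₂ → y ≠ x₃ → v y = none :=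
    fun v hv y h1 h2 h3 => hU y (by simp [h1, h2, h3]) v hv
  subst e₂ e₁ e₃
  rcases hbits with ⟨rfl, rfl, rfl, rfl, rfl, rfl⟩ | ⟨rfl, rfl, rfl, rfl, rfl, rfl⟩
  · refine ⟨x₁, x₂, x₃, _, _, _, P, Q, A, B, C, ⟨h12, h13, h23⟩, hFeq, ⟨hp₁, hp₂, hp₃⟩,
      ⟨?_, hq₂, hq₃⟩, ⟨hA1, ha₂, ha₃⟩, ⟨hb₁, hB2, hb₃⟩, ⟨?_, hc₂, hC3⟩, hrest⟩ <;> simpa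
  · refine ⟨x₁, x₂, x₃, _, _, _, Q, P, A, B, C, ⟨h12, h13, h23⟩, by rw [hFeq, Finset.insert_comm],
      ⟨hq₁, hq₂, hq₃⟩, ⟨?_, hp₂, hp₃⟩, ⟨hA1, ha₂, ha₃⟩, ⟨hb₁, hB2, hb₃⟩, ⟨?_, hc₂, hC3⟩,
      hrest⟩ <;> simpa

end BoolCube

/-! ### From words over `*S` to partial Boolean assignments -/

section Encoding

open Classical in
/-- The partial Boolean assignment of a word, where `B` selects the positive letters. -/
noncomputable def encodeWord {d : ℕ} (c : S → S) (B : Set S) (v : Fin d → Option S) :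
    Fin d × S → Option Bool := fun x =>
  if x.2 ∈ B then
    if v x.1 = some x.2 then some true else if v x.1 = some (c x.2) then some false else none
  else none

variable {d : ℕ} {c : S → S} {B : Set S}

theorem mem_ESet_iff : B ∈ ESet c ↔ ∀ s, c s ∈ B ↔ s ∉ B := by
  refine forall_congr' fun s => ?_
  change (s ∈ B ∧ c s ∉ B) ∨ (c s ∈ B ∧ s ∉ B) ↔ _
  tauto

theorem exists_mem_ESet [Fintype S] (hinv : Function.Involutive c) (hfix : ∀ s, c s ≠ s) :
    ∃ B, B ∈ ESet c := by
  let e := Fintype.equivFin S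
  refine ⟨{s | e s < e (c s)}, mem_ESet_iff.2 fun s => ?_⟩
  have : e s ≠ e (c s) := fun h => hfix s (e.injective h).symm
  change e (c s) < e (c (c s)) ↔ ¬ e s < e (c s)
  rw [hinv s]
  omega

theorem encodeWord_eq_some_iff (hfix : ∀ s, c s ≠ s) {v : Fin d → Option S} {j : Fin d} {s : S}
    {b : Bool} :
    encodeWord c B v (j, s) = some b ↔ s ∈ B ∧ v j = some (bif b then s else c s) := by
  unfold encodeWord
  have := hfix s
  cases b <;> simp only [cond_true, cond_false] <;> split_ifs <;> simp_all [eq_comm]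

theorem exists_literal (hinv : Function.Involutive c) (hB : B ∈ ESet c) (t : S) :
    ∃ s ∈ B, ∃ b, t = bif b then s else c s := by
  rcases hB t with ⟨h, -⟩ | ⟨h, -⟩
  · exact ⟨t, h, true, rfl⟩
  · exact ⟨c t, h, false, (hinv t).symm⟩

theorem literal_not (hinv : Function.Involutive c) (b : Bool) (s : S) :
    (bif !b then s else c s) = c (bif b then s else c s) := by
  cases b <;> simp [hinv s]

theorem literal_unique (hinv : Function.Involutive c) (hB : B ∈ ESet c) {s t : S} (hs : s ∈ B)
    (ht : t ∈ B) {a b : Bool} (h : (bif a then s else c s) = bif b then t else c t) : s = t := by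
  have h1 := mem_ESet_iff.1 hB s
  have h2 := mem_ESet_iff.1 hB t
  cases a <;> cases b <;> simp only [cond_true, cond_false] at h
  · exact hinv.injective h
  · rw [h] at h1; simp_all
  · rw [← h] at h2; simp_all
  · exact h

theorem eq_none_of_encodeWord (hinv : Function.Involutive c) (hfix : ∀ s, c s ≠ s)
    (hB : B ∈ ESet c) {v : Fin d → Option S} {j : Fin d}
    (h : ∀ s, encodeWord c B v (j, s) = none) : v j = none := by
  cases hv : v j with
  | none => rfl
  | some t =>
    obtain ⟨s, hs, b, rfl⟩ := exists_literal hinv hB t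
    have := (encodeWord_eq_some_iff hfix).2 ⟨hs, hv⟩
    simp [h s] at this

theorem eq_of_encodeWord_eq (hinv : Function.Involutive c) (hfix : ∀ s, c s ≠ s)
    (hB : B ∈ ESet c) {u v : Fin d → Option S} {j : Fin d}
    (h : ∀ s, encodeWord c B u (j, s) = encodeWord c B v (j, s)) : u j = v j := by
  cases hv : v j with
  | none =>
    refine eq_none_of_encodeWord hinv hfix hB fun s => ?_
    rw [h]
    unfold encodeWord
    simp [hv]
  | some t =>
    obtain ⟨s, hs, b, rfl⟩ := exists_literal hinv hB t
    have := (encodeWord_eq_some_iff hfix).2 ⟨hs, hv⟩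
    rw [← h] at this
    exact ((encodeWord_eq_some_iff hfix).1 this).2

theorem encodeWord_injective (hinv : Function.Involutive c) (hfix : ∀ s, c s ≠ s)
    (hB : B ∈ ESet c) : Function.Injective (encodeWord (d := d) c B) :=
  fun _ _ h => funext fun _ => eq_of_encodeWord_eq hinv hfix hB fun _ => congrFun h _

theorem DichoStar.clash (hinv : Function.Involutive c) (hfix : ∀ s, c s ≠ s) (hB : B ∈ ESet c)
    {u v : Fin d → Option S} (h : DichoStar c u v) :
    BoolCube.Clash (encodeWord c B u) (encodeWord c B v) := by
  obtain ⟨j, t, hu, hv⟩ := h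
  obtain ⟨s, hs, b, rfl⟩ := exists_literal hinv hB t
  refine ⟨(j, s), b, (encodeWord_eq_some_iff hfix).2 ⟨hs, hu⟩,
    (encodeWord_eq_some_iff hfix).2 ⟨hs, ?_⟩⟩
  rw [hv, literal_not hinv]

theorem TwinPairStar.of_twin (hinv : Function.Involutive c) (hfix : ∀ s, c s ≠ s)
    (hB : B ∈ ESet c) {u v : Fin d → Option S}
    (h : BoolCube.Twin (encodeWord c B u) (encodeWord c B v)) : TwinPairStar c u v := by
  obtain ⟨⟨j, s⟩, b, ⟨hu, hv⟩, h⟩ := h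
  refine ⟨j, ⟨_, ((encodeWord_eq_some_iff hfix).1 hu).2, ?_⟩, fun i hi => ?_⟩
  · rw [((encodeWord_eq_some_iff hfix).1 hv).2, literal_not hinv]
  · exact eq_of_encodeWord_eq hinv hfix hB fun t => h (i, t) fun h => hi (congrArg Prod.fst h)

/-- Every Boolean point comes from a point of the box `(ES)^d`. -/
theorem exists_point (hinv : Function.Involutive c) (hfix : ∀ s, c s ≠ s) (hB : B ∈ ESet c)
    (p : Fin d × S → Bool) : ∃ x : Fin d → Set S, (∀ i, x i ∈ ESet c) ∧
      ∀ v : Fin d → Option S, x ∈ RealizeStar c v → BoolCube.Agree p (encodeWord c B v) := by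
  refine ⟨fun i => {s | (s ∈ B ∧ p (i, s) = true) ∨ (s ∉ B ∧ p (i, c s) = false)},
    fun i => mem_ESet_iff.2 fun s => ?_, fun v hv => ?_⟩
  · have hs := mem_ESet_iff.1 hB s
    simp only [Set.mem_ofPred_eq, hinv s]
    by_cases h : s ∈ B <;> simp [hs, h]
  · rintro ⟨j, s⟩ b h
    obtain ⟨hs, hj⟩ := (encodeWord_eq_some_iff hfix).1 h
    have h1 := hv j
    rw [hj] at h1
    have h2 := h1.2
    have h3 := mem_ESet_iff.1 hB s
    cases b <;> simp_all [hinv s]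

theorem PartitionCodeStar.isPartition_image [DecidableEq (Fin d × S → Option Bool)]
    (hinv : Function.Involutive c) (hfix : ∀ s, c s ≠ s)
    (hB : B ∈ ESet c) {V : Finset (Fin d → Option S)}
    (hV : PartitionCodeStar c (V : Set (Fin d → Option S))) :
    BoolCube.IsPartition (V.image (encodeWord c B)) fun _ => none := by
  refine ⟨?_, fun u _ x b h => by simp at h, fun p _ => ?_⟩
  · simp only [Finset.mem_image]
    rintro _ ⟨u, hu, rfl⟩ _ ⟨v, hv, rfl⟩ huv
    exact (hV.1 u hu v hv fun h => huv (by rw [h])).clash hinv hfix hB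
  · obtain ⟨x, hx, hp⟩ := exists_point hinv hfix hB p
    have hx' : x ∈ RealizeSetStar c (V : Set (Fin d → Option S)) := by rw [hV.2]; exact hx
    simp only [RealizeSetStar, Set.mem_iUnion] at hx'
    obtain ⟨v, hv, hxv⟩ := hx'
    exact ⟨_, Finset.mem_image_of_mem _ hv, hp v hxv⟩

end Encoding

theorem partition_code_five_words_no_twin {d : ℕ} [Fintype S] (c : S → S)
    (hinv : Function.Involutive c) (hfix : ∀ s, c s ≠ s) (hd : 3 ≤ d)
    (V : Set (Fin d → Option S)) (hV : PartitionCodeStar c V)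
    (hcard : V.ncard = 5) (htp : NoTwinPairStar c V) :
    ∃ (i₁ i₂ i₃ : Fin d), i₁ ≠ i₂ ∧ i₁ ≠ i₃ ∧ i₂ ≠ i₃ ∧ ∃ (l₁ l₂ l₃ : S),
      ∃ v₁ v₂ v₃ v₄ v₅ : Fin d → Option S,
        V = {v₁, v₂, v₃, v₄, v₅} ∧
        v₁ i₁ = some l₁ ∧ v₁ i₂ = some l₂ ∧ v₁ i₃ = some l₃ ∧
        v₂ i₁ = some (c l₁) ∧ v₂ i₂ = some (c l₂) ∧ v₂ i₃ = some (c l₃) ∧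
        v₃ i₁ = none ∧ v₃ i₂ = some (c l₂) ∧ v₃ i₃ = some l₃ ∧
        v₄ i₁ = some l₁ ∧ v₄ i₂ = none ∧ v₄ i₃ = some (c l₃) ∧
        v₅ i₁ = some (c l₁) ∧ v₅ i₂ = some l₂ ∧ v₅ i₃ = none ∧
        ∀ j, j ≠ i₁ → j ≠ i₂ → j ≠ i₃ →
          v₁ j = none ∧ v₂ j = none ∧ v₃ j = none ∧ v₄ j = none ∧ v₅ j = none := by
  classical
  obtain ⟨B, hB⟩ := exists_mem_ESet hinv hfix
  have hfin : V.Finite := Set.finite_of_ncard_ne_zero (by omega)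
  obtain ⟨V, rfl⟩ := hfin.exists_finset_coe
  rw [Set.ncard_coe_finset] at hcard
  have hPart := hV.isPartition_image hinv hfix hB
  have hinj : Function.Injective (encodeWord (d := d) c B) := encodeWord_injective hinv hfix hB
  have htw : ∀ u ∈ V.image (encodeWord c B), ∀ v ∈ V.image (encodeWord c B),
      ¬ BoolCube.Twin u v := by
    simp only [Finset.mem_image]
    rintro _ ⟨u, hu, rfl⟩ _ ⟨v, hv, rfl⟩ h
    exact htp u hu v hv (.of_twin hinv hfix hB h)
  obtain ⟨⟨i₁, s₁⟩, ⟨i₂, s₂⟩, ⟨i₃, s₃⟩, b₁, b₂, b₃, w₁, w₂, w₃, w₄, w₅, ⟨n12, n13, n23⟩, hF,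
    h1, h2, h3, h4, h5, hrest⟩ := hPart.eq_five htw (by rw [Finset.card_image_of_injective _ hinj, hcard])
  have hex : ∀ w ∈ ({w₁, w₂, w₃, w₄, w₅} : Finset _), ∃ v ∈ V, encodeWord c B v = w := by
    intro w hw
    rw [← hF] at hw
    simpa using hw
  obtain ⟨v₁, m1, rfl⟩ := hex w₁ (by simp)
  obtain ⟨v₂, m2, rfl⟩ := hex w₂ (by simp)
  obtain ⟨v₃, m3, rfl⟩ := hex w₃ (by simp)
  obtain ⟨v₄, m4, rfl⟩ := hex w₄ (by simp)
  obtain ⟨v₅, m5, rfl⟩ := hex w₅ (by simp)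
  have hVeq : V = {v₁, v₂, v₃, v₄, v₅} := by
    apply Finset.image_injective hinj
    rw [hF]
    simp [Finset.image_insert]
  simp only [encodeWord_eq_some_iff hfix, literal_not hinv] at h1 h2 h3 h4 h5
  obtain ⟨⟨hs₁, g11⟩, ⟨hs₂, g12⟩, ⟨hs₃, g13⟩⟩ := h1
  obtain ⟨⟨-, g21⟩, ⟨-, g22⟩, ⟨-, g23⟩⟩ := h2
  obtain ⟨g31, ⟨-, g32⟩, ⟨-, g33⟩⟩ := h3
  obtain ⟨⟨-, g41⟩, g42, ⟨-, g43⟩⟩ := h4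
  obtain ⟨⟨-, g51⟩, ⟨-, g52⟩, g53⟩ := h5
  have d12 : i₁ ≠ i₂ := by
    rintro rfl
    rw [g11] at g12
    exact n12 (by rw [literal_unique hinv hB hs₁ hs₂ (Option.some.inj g12)])
  have d13 : i₁ ≠ i₃ := by
    rintro rfl
    rw [g11] at g13
    exact n13 (by rw [literal_unique hinv hB hs₁ hs₃ (Option.some.inj g13)])
  have d23 : i₂ ≠ i₃ := by
    rintro rfl
    rw [g12] at g13
    exact n23 (by rw [literal_unique hinv hB hs₂ hs₃ (Option.some.inj g13)])
  have hnone : ∀ v ∈ V, ∀ j, (j = i₁ → encodeWord c B v (i₁, s₁) = none) →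
      (j = i₂ → encodeWord c B v (i₂, s₂) = none) →
      (j = i₃ → encodeWord c B v (i₃, s₃) = none) → v j = none := by
    intro v hv j k1 k2 k3
    refine eq_none_of_encodeWord hinv hfix hB fun s => ?_
    by_contra hne
    have hr := hrest _ (Finset.mem_image_of_mem _ hv) (j, s)
    by_cases e1 : (j, s) = (i₁, s₁)
    · exact hne (e1 ▸ k1 (congrArg Prod.fst e1))
    by_cases e2 : (j, s) = (i₂, s₂)
    · exact hne (e2 ▸ k2 (congrArg Prod.fst e2))
    by_cases e3 : (j, s) = (i₃, s₃)
    · exact hne (e3 ▸ k3 (congrArg Prod.fst e3))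
    exact hne (hr e1 e2 e3)
  refine ⟨i₁, i₂, i₃, d12, d13, d23, _, _, _, v₁, v₂, v₃, v₄, v₅, by rw [hVeq]; simp,
    g11, g12, g13, g21, g22, g23,
    hnone _ m3 _ (fun _ => g31) (fun h => absurd h d12) (fun h => absurd h d13), g32, g33,
    g41, hnone _ m4 _ (fun h => absurd h.symm d12) (fun _ => g42) (fun h => absurd h d23), g43,
    g51, g52, hnone _ m5 _ (fun h => absurd h.symm d13) (fun h => absurd h.symm d23) (fun _ => g53),
    fun j j1 j2 j3 => ?_⟩
  have hj : ∀ v ∈ V, v j = none := fun v hv =>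
    hnone v hv j (fun h => absurd h j1) (fun h => absurd h j2) (fun h => absurd h j3)
  exact ⟨hj _ m1, hj _ m2, hj _ m3, hj _ m4, hj _ m5⟩
end
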